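/- arXiv:1901.11131 — 17 statements merged into one kernel-verified Lean document; each statement's English description precedes it below -/
import Mathlib

section
/- Let f : ℝ → ℝ, let u, v, w, M be real constants, and suppose f(x + y) = f(x + u) + f(y + v) + w for all x ≥ M and y ≥ M. Then there exist a real constant N and a real constant d such that f(x + y) = f(x) + f(y) + d for all x ≥ N and y ≥ N; equivalently, the function c(x) = f(x) + d satisfies Cauchy's equation c(x + y) = c(x) + c(y) for all sufficiently large x, y. -/
theorem cauchy_type_lemma (f : ℝ → ℝ) (u v w M : ℝ)
    (h : ∀ x ≥ M, ∀ y ≥ M, f (x + y) = f (x + u) + f (y + v) + w) :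
    ∃ N d : ℝ, ∀ x ≥ N, ∀ y ≥ N, f (x + y) = f x + f y + d := by
  obtain ⟨A, hA⟩ : ∃ A, A = |M| + |v| + 2 * |u| := ⟨_, rfl⟩
  refine ⟨|M| + 3 * |u|, f (M + v) - f (M + u) + w + f (A + 2 * u) - f A, fun x hx y hy => ?_⟩
  have hM := le_abs_self M
  have hM₀ := abs_nonneg M
  have hu := le_abs_self u
  have hu' := neg_abs_le u
  have hv := le_abs_self v
  have hsum := h (x - u) (by linarith) (y - u) (by linarith)
  have hy_left := h (y - u) (by linarith) M le_rfl
  have hy_right := h M le_rfl (y - u) (by linarith)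
  have hshift := h (x + y - u) (by linarith) (A - v) (by linarith)
  have hshift' := h (x + y - 3 * u) (by linarith) (A + 2 * u - v) (by linarith)
  rw [show x - u + (y - u) = x + y - 2 * u by ring, sub_add_cancel] at hsum
  rw [sub_add_cancel, add_comm (y - u) M] at hy_left
  rw [sub_add_cancel, sub_add_cancel] at hshift
  rw [show x + y - 3 * u + (A + 2 * u - v) = x + y - u + (A - v) by ring,
    show x + y - 3 * u + u = x + y - 2 * u by ring, sub_add_cancel] at hshift'
  linarith
end

section
/- A function f : ℝ → ℝ satisfies f(f(x) + x·y) + f(y²) = 2017·x + y·f(x + y) for all real x, y if and only if f(x) = √2017 · x for all real x, or f(x) = −√2017 · x for all real x. -/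
/-- Every solution of the functional equation is linear, with slope a square root of `2017`. -/
lemma linear_of_functional_equation {f : ℝ → ℝ}
    (h : ∀ x y : ℝ, f (f x + x * y) + f (y ^ 2) = 2017 * x + y * f (x + y)) :
    (f 1) ^ 2 = 2017 ∧ ∀ x, f x = f 1 * x := by
  have f_zero : f 0 = 0 := by
    have h₀ := h 0 0
    have h₁ := h 0 1
    norm_num at h₀ h₁
    linarith
  have f_f (x : ℝ) : f (f x) = 2017 * x := by
    simpa [f_zero] using h x 0
  have f_sq (y : ℝ) : f (y ^ 2) = y * f y := by
    simpa [f_zero] using h 0 y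
  have f_neg (y : ℝ) : f (-y) = -f y := by
    rcases eq_or_ne y 0 with rfl | hy
    · simp [f_zero]
    · have h₁ := f_sq (-y)
      rw [neg_sq, f_sq] at h₁
      exact mul_left_cancel₀ hy (by linarith)
  have sub_eq (z w : ℝ) : f (z + w) - f (z - w) = 2 * f w := by
    obtain ⟨x, rfl⟩ : ∃ x, f x = w := ⟨f (w / 2017), by rw [f_f]; ring⟩
    rcases eq_or_ne x 0 with rfl | hx
    · simp [f_zero]
    · have h₁ := h x (z / x)
      have h₂ := h (-x) (-(z / x))
      have hz : x * (z / x) = z := by field_simp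
      rw [neg_mul_neg, hz, f_neg x, neg_sq, ← neg_add, f_neg (x + z / x)] at h₂
      rw [hz] at h₁
      rw [f_f, add_comm z, sub_eq_neg_add z]
      linarith
  have f_add (a b : ℝ) : f (a + b) = f a + f b := by
    have h₁ := sub_eq (a + b / 2) (b / 2)
    have h₂ := sub_eq (b / 2) (b / 2)
    rw [show a + b / 2 + b / 2 = a + b by ring, add_sub_cancel_right] at h₁
    rw [add_halves, sub_self, f_zero] at h₂
    linarith
  have f_linear (x : ℝ) : f x = f 1 * x := by
    have h₁ := f_sq (x + 1)
    rw [show (x + 1) ^ 2 = x ^ 2 + (x + x) + 1 by ring] at h₁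
    simp only [f_add, f_sq] at h₁
    linarith
  refine ⟨?_, f_linear⟩
  have h₁ := f_f 1
  rw [f_linear (f 1)] at h₁
  linarith

theorem problem_1 (f : ℝ → ℝ) :
    (∀ x y : ℝ, f (f x + x * y) + f (y ^ 2) = 2017 * x + y * f (x + y)) ↔
    (∀ x : ℝ, f x = Real.sqrt 2017 * x) ∨ (∀ x : ℝ, f x = -Real.sqrt 2017 * x) := by
  have sqrt_sq : Real.sqrt 2017 ^ 2 = 2017 := Real.sq_sqrt (by norm_num)
  constructor
  · intro h
    obtain ⟨slope_sq, f_linear⟩ := linear_of_functional_equation h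
    rcases sq_eq_sq_iff_eq_or_eq_neg.mp (slope_sq.trans sqrt_sq.symm) with hc | hc
    · exact Or.inl fun x => by rw [f_linear, hc]
    · exact Or.inr fun x => by rw [f_linear, hc]
  · rintro (h | h) x y <;> simp only [h] <;> linear_combination x * sqrt_sq
end

section
/- A function f from the positive integers to the positive integers satisfies (f(a) + b) · f(a + f(b)) = (a + f(b))² for all positive integers a, b if and only if f(n) = n for all positive integers n. -/
/-- Under the functional equation, every positive multiple of `1 + f 1` is a fixed point of `f`. -/
theorem fixed_mul_one_add {f : ℕ → ℕ}
    (h : ∀ a b : ℕ, 1 ≤ a → 1 ≤ b → (f a + b) * f (a + f b) = (a + f b) ^ 2) (k : ℕ) :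
    f ((k + 1) * (1 + f 1)) = (k + 1) * (1 + f 1) := by
  have base : f (1 + f 1) = 1 + f 1 := by
    have h₁ := h 1 1 le_rfl le_rfl
    refine Nat.eq_of_mul_eq_mul_left (show 0 < 1 + f 1 by omega) ?_
    rw [← sq, ← h₁, add_comm (f 1) 1]
  induction k with
  | zero => simpa using base
  | succ k ih =>
    have hk : 0 < (k + 1) * (1 + f 1) := by positivity
    have h₂ := h ((k + 1) * (1 + f 1)) (1 + f 1) hk (by omega)
    rw [ih, base, ← Nat.succ_mul, sq] at h₂
    exact Nat.eq_of_mul_eq_mul_left (by positivity) h₂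

theorem problem_3 (f : ℕ → ℕ) (hf : ∀ n : ℕ, 1 ≤ n → 1 ≤ f n) :
    (∀ a b : ℕ, 1 ≤ a → 1 ≤ b → (f a + b) * f (a + f b) = (a + f b) ^ 2) ↔
    (∀ n : ℕ, 1 ≤ n → f n = n) := by
  constructor
  · intro h a ha
    set k := (((a : ℤ) - f a) ^ 2).toNat with hk
    set c := (k + 1) * (1 + f 1) with hc
    have hfc : f c = c := fixed_mul_one_add h k
    have hkc : k < c := by rw [hc]; nlinarith [Nat.zero_le (f 1), Nat.zero_le k]
    have hac := h a c ha (by omega)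
    rw [hfc] at hac
    have hac' : ((f a : ℤ) + c) * f (a + c) = (a + c) ^ 2 := mod_cast hac
    have hdvd : (f a : ℤ) + c ∣ ((a : ℤ) - f a) ^ 2 :=
      ⟨f (a + c) - 2 * (a + c) + (f a + c), by linear_combination -hac'⟩
    have hzero : ((a : ℤ) - f a) ^ 2 = 0 :=
      Int.eq_zero_of_dvd_of_nonneg_of_lt (sq_nonneg _) (by omega) hdvd
    have := pow_eq_zero_iff two_ne_zero |>.mp hzero
    omega
  · intro h a b ha hb
    rw [h b hb, h a ha, h (a + b) (by omega), sq]
end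

section
/- A function f from the positive integers to the positive integers satisfies f(m² + f(n)) = f(m)² + n for all positive integers m, n if and only if f(n) = n for all positive integers n. -/
/-- A function on the positive integers that gains `b` over each step of length `a` gains `k * b`
over `k` such steps (with `b = q - p` written without subtraction). -/
lemma add_mul_of_add_step {f : ℕ → ℕ} {a p q : ℕ}
    (h : ∀ n, 1 ≤ n → f (n + a) + p = f n + q) (k n : ℕ) (hn : 1 ≤ n) :
    f (n + k * a) + k * p = f n + k * q := by
  induction k with
  | zero => simp
  | succ k ih =>
    have h' := h (n + k * a) (by omega)
    have e : n + (k + 1) * a = n + k * a + a := by ring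
    rw [e]
    linarith

theorem problem_4 (f : ℕ → ℕ) (hf : ∀ n : ℕ, 1 ≤ n → 1 ≤ f n) :
    (∀ m n : ℕ, 1 ≤ m → 1 ≤ n → f (m ^ 2 + f n) = f m ^ 2 + n) ↔
    (∀ n : ℕ, 1 ≤ n → f n = n) := by
  constructor
  · intro h
    have shift : ∀ m n, 1 ≤ m → 1 ≤ n → f (n + (m ^ 2 + f 1 ^ 2)) = f n + (f m ^ 2 + 1) := by
      intro m n hm hn
      have h₁ := h m (1 ^ 2 + f n) hm (by omega)
      rw [h 1 n le_rfl hn] at h₁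
      rw [show n + (m ^ 2 + f 1 ^ 2) = m ^ 2 + (f 1 ^ 2 + n) by ring, h₁]
      ring
    have period : ∀ n, 1 ≤ n → f (n + (1 + f 1 ^ 2)) + 0 = f n + (f 1 ^ 2 + 1) := by
      intro n hn
      simpa using shift 1 n le_rfl hn
    have three : ∀ n, 1 ≤ n → f (n + 3) + f 1 ^ 2 = f n + f 2 ^ 2 := by
      intro n hn
      have h₁ := period (n + 3) (by omega)
      have h₂ := shift 2 n (by omega) hn
      rw [show n + (2 ^ 2 + f 1 ^ 2) = n + 3 + (1 + f 1 ^ 2) by ring] at h₂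
      omega
    have hsq : f 2 ^ 2 = f 1 ^ 2 + 3 := by
      have h₁ := add_mul_of_add_step period 3 1 le_rfl
      have h₂ := add_mul_of_add_step three (1 + f 1 ^ 2) 1 le_rfl
      rw [mul_comm (1 + f 1 ^ 2) 3] at h₂
      have h₃ : (1 + f 1 ^ 2) * f 2 ^ 2 = (1 + f 1 ^ 2) * (f 1 ^ 2 + 3) := by linarith
      exact Nat.eq_of_mul_eq_mul_left (by omega) h₃
    have pos := hf 1 le_rfl
    have hlt : f 1 < f 2 := by nlinarith
    have h1 : f 1 = 1 := by nlinarith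
    have h2 : f 2 = 2 := by
      rw [h1] at hsq
      nlinarith
    intro n
    induction n using Nat.strong_induction_on with
    | _ n ih =>
      intro hn
      obtain rfl | rfl | hn : n = 1 ∨ n = 2 ∨ 3 ≤ n := by omega
      · exact h1
      · exact h2
      · obtain ⟨k, rfl⟩ := Nat.exists_eq_add_of_le' hn
        have h₁ := period (k + 1) (by omega)
        rw [h1, ih (k + 1) (by omega) (by omega)] at h₁
        exact h₁
  · intro h m n hm hn
    rw [h n hn, h m hm, h _ (by omega)]
end

section
/- Let f : ℝ → ℝ satisfy f(x) > 0 for all x > 0. Then f satisfies f(x² + f(y)) = x·f(x) + y for all x > 0 and y > 0 if and only if f(x) = x for all x > 0. -/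
/-- Iterating a quasi-translation identity on the positive reals. -/
lemma apply_add_nat_mul {f : ℝ → ℝ} {a b : ℝ} (ha : 0 < a)
    (hf : ∀ y, 0 < y → f (y + a) = f y + b) (n : ℕ) {y : ℝ} (hy : 0 < y) :
    f (y + n * a) = f y + n * b := by
  induction n with
  | zero => simp
  | succ n ih =>
    have h := hf (y + n * a) (by positivity)
    push_cast
    rw [show y + (n + 1) * a = y + n * a + a by ring, h, ih]
    ring

/-- If a function positive on the positive reals commutes with translation by some `h > 0`, then
any other translation cannot shift its values by less than the translation length. -/
lemma le_of_apply_add_eq {f : ℝ → ℝ} (hpos : ∀ x, 0 < x → 0 < f x) {a b h : ℝ}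
    (ha : 0 < a) (hh : 0 < h) (hfa : ∀ y, 0 < y → f (y + a) = f y + b)
    (hfh : ∀ y, 0 < y → f (y + h) = f y + h) : a ≤ b := by
  by_contra! hlt
  obtain ⟨n, hn⟩ := exists_nat_gt ((f 1 + h) / (a - b))
  rw [div_lt_iff₀ (sub_pos.2 hlt)] at hn
  have hle : (⌊n * a / h⌋₊ : ℝ) * h ≤ n * a :=
    (le_div_iff₀ hh).1 (Nat.floor_le (by positivity))
  have hgt : n * a < ((⌊n * a / h⌋₊ : ℝ) + 1) * h :=
    (div_lt_iff₀ hh).1 (Nat.lt_floor_add_one _)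
  have hy : 0 < 1 + n * a - (⌊n * a / h⌋₊ : ℝ) * h := by linarith
  have h₁ := apply_add_nat_mul ha hfa n one_pos
  have h₂ := apply_add_nat_mul hh hfh ⌊n * a / h⌋₊ hy
  rw [sub_add_cancel] at h₂
  linarith [hpos _ hy]

theorem problem_8 (f : ℝ → ℝ) (hpos : ∀ x : ℝ, 0 < x → 0 < f x) :
    (∀ x : ℝ, 0 < x → ∀ y : ℝ, 0 < y → f (x ^ 2 + f y) = x * f x + y) ↔
    (∀ x : ℝ, 0 < x → f x = x) := by
  constructor
  · intro hf
    have hshift : ∀ x, 0 < x → ∀ z, 0 < z → ∀ y, 0 < y →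
        f (y + (x ^ 2 + z * f z)) = f y + (z ^ 2 + x * f x) := by
      intro x hx z hz y hy
      have hfy := hpos y hy
      have h := hf x hx (z ^ 2 + f y) (by positivity)
      rw [hf z hz y hy] at h
      rw [show y + (x ^ 2 + z * f z) = x ^ 2 + (z * f z + y) by ring, h]
      ring
    have hle : ∀ x, 0 < x → ∀ z, 0 < z → x ^ 2 + z * f z ≤ z ^ 2 + x * f x := by
      intro x hx z hz
      have hfx := hpos x hx
      have hfz := hpos z hz
      exact le_of_apply_add_eq hpos (by positivity) (by positivity) (hshift x hx z hz)
        (hshift x hx x hx)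
    obtain ⟨k, hk⟩ : ∃ k, ∀ x, 0 < x → x * f x = x ^ 2 + k :=
      ⟨f 1 - 1, fun x hx => by linarith [hle x hx 1 one_pos, hle 1 one_pos x hx]⟩
    have hk_nonneg : 0 ≤ k := by
      by_contra! hneg
      have hs : 0 < √(-k) := Real.sqrt_pos.2 (by linarith)
      have h := hk _ hs
      rw [Real.sq_sqrt (by linarith)] at h
      linarith [mul_pos hs (hpos _ hs)]
    have hk_zero : k = 0 := by
      by_contra hne
      have hkp : 0 < k := lt_of_le_of_ne hk_nonneg (Ne.symm hne)
      have hu : 0 < k + 1 := by linarith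
      have hv : 0 < k / (k + 1) := by positivity
      have hform : ∀ x, 0 < x → f x = x + k / x := fun x hx => by
        have := hk x hx
        field_simp
        linarith
      have heq : f (k + 1) = f (k / (k + 1)) := by
        rw [hform _ hu, hform _ hv, div_div_cancel₀ hkp.ne', add_comm]
      have h₁ := hf 1 one_pos _ hu
      have h₂ := hf 1 one_pos _ hv
      rw [heq, h₂] at h₁
      have h₃ : k / (k + 1) = k + 1 := by linarith
      rw [div_eq_iff hu.ne'] at h₃
      nlinarith
    intro x hx
    have h := hk x hx
    rw [hk_zero, add_zero, sq] at h
    exact mul_left_cancel₀ hx.ne' h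
  · intro hf x hx y hy
    rw [hf y hy, hf x hx, hf _ (by positivity), sq]
end

section
/- A function f : ℝ → ℝ satisfies f(f(y) + x² + 1) + 2x = y + (f(x + 1))² for all real x, y if and only if f(x) = x for all real x. -/
theorem problem_9 (f : ℝ → ℝ) :
    (∀ x y : ℝ, f (f y + x ^ 2 + 1) + 2 * x = y + (f (x + 1)) ^ 2) ↔
    (∀ x : ℝ, f x = x) := by
  refine ⟨fun h => ?_, fun h x y => by simp only [h]; ring⟩
  have surj : Function.Surjective f := fun z =>
    ⟨f (z - f 1 ^ 2) + 0 ^ 2 + 1, by linear_combination (norm := ring_nf) h 0 (z - f 1 ^ 2)⟩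
  have shift : ∀ u x, f (u + x ^ 2) = f u + (f (x + 1) ^ 2 - 2 * x - f 1 ^ 2) := by
    intro u x
    obtain ⟨y, hy⟩ := surj (u - 1)
    have h₀ := h 0 y
    have hx := h x y
    rw [hy, show u - 1 + x ^ 2 + 1 = u + x ^ 2 by ring] at hx
    rw [hy, show u - 1 + (0 : ℝ) ^ 2 + 1 = u by ring, zero_add] at h₀
    linarith
  have increment : ∀ s, f 1 * (f (s + 1) ^ 2 - 2 * s - f 1 ^ 2) = s ^ 2 := by
    intro s
    have hp := shift 1 s
    have hm := shift (1 - s ^ 2) s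
    rw [sub_add_cancel] at hm
    have even₁ := h (s ^ 2) 0
    have even₂ := h (-s ^ 2) 0
    rw [neg_sq] at even₂
    rw [add_comm (s ^ 2) 1, hp] at even₁
    rw [show -s ^ 2 + 1 = 1 - s ^ 2 by ring, eq_sub_of_add_eq hm.symm] at even₂
    linear_combination (even₂ - even₁) / 4
  have step : ∀ u t, 0 ≤ t → f 1 * f (u + t) = f 1 * f u + t := by
    intro u t ht
    have hs := shift u (√t)
    have hi := increment (√t)
    rw [Real.sq_sqrt ht] at hs hi
    rw [hs]
    linear_combination hi
  have affine : ∀ x, f 1 * f x = f 1 * f 1 + (x - 1) := by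
    intro x
    rcases le_total 1 x with hx | hx
    · simpa using step 1 (x - 1) (by linarith)
    · have := step x (1 - x) (by linarith)
      rw [add_sub_cancel] at this
      linarith
  have hone : f 1 = 1 := by
    have hi := increment 1
    have ha := affine (1 + 1)
    linear_combination (f 1 * f (1 + 1) + f 1 * f 1 + 1) * ha - f 1 * hi
  intro x
  simpa [hone] using affine x
end

section
/- Let n ≥ 2 be a fixed positive integer. A function f : ℝ → ℝ satisfies f(xⁿ + f(y)) = f(x)ⁿ + y for all real x, y if and only if f(x) = x for all real x, or n is odd and f(x) = −x for all real x. -/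
open Polynomial in
/-- An additive map that commutes with the `n`-th power satisfies the identity obtained by comparing
the coefficients of `m ^ (n - 2)` in `f ((m + x) ^ n) = f (m + x) ^ n`. -/
theorem AddMonoidHom.map_sq_of_map_pow {n : ℕ} (hn : 2 ≤ n) (f : ℝ →+ ℝ)
    (hf : ∀ x, f (x ^ n) = f x ^ n) (x : ℝ) : f (x ^ 2) = f 1 ^ (n - 2) * f x ^ 2 := by
  let P : ℝ[X] := ∑ j ∈ Finset.range (n + 1), C (n.choose j * f (x ^ (n - j))) * X ^ j
  let Q : ℝ[X] := ∑ j ∈ Finset.range (n + 1), C (n.choose j * (f 1 ^ j * f x ^ (n - j))) * X ^ j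
  have f_natCast_mul (m : ℕ) (y : ℝ) : f (m * y) = m * f y := by
    simpa using map_nsmul f m y
  have eval_eq (m : ℕ) : P.eval (m : ℝ) = Q.eval (m : ℝ) := by
    have hP : P.eval (m : ℝ) = f ((m + x) ^ n) := by
      simp only [P, eval_finsetSum, eval_mul, eval_C, eval_pow, eval_X, add_pow, map_sum]
      refine Finset.sum_congr rfl fun j _ => ?_
      have := f_natCast_mul (m ^ j * n.choose j) (x ^ (n - j))
      push_cast at this
      rw [show (m : ℝ) ^ j * x ^ (n - j) * n.choose j = m ^ j * n.choose j * x ^ (n - j) by ring,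
        this]
      ring
    have hQ : Q.eval (m : ℝ) = (m * f 1 + f x) ^ n := by
      simp only [Q, eval_finsetSum, eval_mul, eval_C, eval_pow, eval_X, add_pow]
      refine Finset.sum_congr rfl fun j _ => ?_
      ring
    rw [hP, hQ, hf, map_add, ← f_natCast_mul, mul_one]
  have hPQ : P = Q := by
    refine eq_of_infinite_eval_eq P Q ((Set.infinite_range_of_injective
      (Nat.cast_injective (R := ℝ))).mono ?_)
    rintro _ ⟨m, rfl⟩
    exact eval_eq m
  have hcoeff := congrArg (fun R => coeff R (n - 2)) hPQ
  have hmem : n - 2 < n + 1 := by omega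
  have hchoose : (n.choose (n - 2) : ℝ) ≠ 0 := by
    exact_mod_cast (Nat.choose_pos (Nat.sub_le n 2)).ne'
  simp only [P, Q, finsetSum_coeff, coeff_C_mul, coeff_X_pow, mul_ite, mul_one, mul_zero,
    Finset.sum_ite_eq, Finset.mem_range, hmem, if_true, Nat.sub_sub_self hn] at hcoeff
  exact mul_left_cancel₀ hchoose hcoeff

/-- Every solution of the functional equation vanishes at zero. -/
theorem map_zero_of_map_pow_add {n : ℕ} (hn : 2 ≤ n) {f : ℝ → ℝ}
    (h : ∀ x y : ℝ, f (x ^ n + f y) = f x ^ n + y) : f 0 = 0 := by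
  have hn0 : n ≠ 0 := by omega
  set d := f 0 ^ n with hd
  have hff (y : ℝ) : f (f y) = y + d := by
    have := h 0 y
    rw [zero_pow hn0, zero_add] at this
    rw [this, hd, add_comm]
  have key (x : ℝ) : (x + d) ^ n = x ^ n + 2 * d := by
    have h1 := h (f x) 0
    have h2 : f (f (x ^ n + f (f 0))) = f (f x ^ n + f 0) := by rw [h]
    rw [hff] at h1 h2
    rw [hff 0] at h2
    linarith
  have h0 := key 0
  have h1 := key d
  rw [zero_add, zero_pow hn0, zero_add] at h0
  rw [← two_mul, mul_pow, ← h0] at h1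
  have h4 : (4 : ℝ) ≤ 2 ^ n := by
    calc (4 : ℝ) = 2 ^ 2 := by norm_num
      _ ≤ 2 ^ n := pow_le_pow_right₀ (by norm_num) hn
  have hd0 : d ^ n = 0 := by
    have : (2 ^ n - 2 : ℝ) * d ^ n = 0 := by linarith
    exact (mul_eq_zero.mp this).resolve_left (by linarith)
  exact eq_zero_of_pow_eq_zero (eq_zero_of_pow_eq_zero hd0)

/-- Every solution of the functional equation is additive. -/
theorem map_add_of_map_pow_add {n : ℕ} (hn : 2 ≤ n) {f : ℝ → ℝ}
    (h : ∀ x y : ℝ, f (x ^ n + f y) = f x ^ n + y) (x y : ℝ) : f (x + y) = f x + f y := by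
  have hn0 : n ≠ 0 := by omega
  have f_zero := map_zero_of_map_pow_add hn h
  have hff (y : ℝ) : f (f y) = y := by simpa [f_zero, hn0] using h 0 y
  have hpow (x : ℝ) : f (x ^ n) = f x ^ n := by simpa [f_zero] using h x 0
  have add_of_nonneg {t : ℝ} (ht : 0 ≤ t) (y : ℝ) : f (t + y) = f t + f y := by
    have := h (t ^ (n⁻¹ : ℝ)) (f y)
    rwa [← hpow, Real.rpow_inv_natCast_pow ht hn0, hff] at this
  rcases le_total 0 x with hx | hx
  · exact add_of_nonneg hx y
  · have h1 := add_of_nonneg (neg_nonneg.mpr hx) (x + y)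
    have h2 := add_of_nonneg (neg_nonneg.mpr hx) x
    rw [neg_add_cancel_left] at h1
    rw [neg_add_cancel, f_zero] at h2
    linarith

theorem problem_10 (n : ℕ) (hn : 2 ≤ n) (f : ℝ → ℝ) :
    (∀ x y : ℝ, f (x ^ n + f y) = (f x) ^ n + y) ↔
    (∀ x : ℝ, f x = x) ∨ (Odd n ∧ ∀ x : ℝ, f x = -x) := by
  constructor
  · intro h
    have hn0 : n ≠ 0 := by omega
    have f_zero := map_zero_of_map_pow_add hn h
    have hff (y : ℝ) : f (f y) = y := by simpa [f_zero, hn0] using h 0 y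
    have hpow (x : ℝ) : f (x ^ n) = f x ^ n := by simpa [f_zero] using h x 0
    let F : ℝ →+ ℝ := AddMonoidHom.mk' f (map_add_of_map_pow_add hn h)
    have hsq (x : ℝ) : f (x ^ 2) = f 1 ^ (n - 2) * f x ^ 2 :=
      F.map_sq_of_map_pow hn hpow x
    have hk0 : f 1 ≠ 0 := fun h0 => by
      have := hff 1
      rw [h0, f_zero] at this
      exact zero_ne_one this
    have hk : f 1 ^ (n - 1) = 1 := by
      have := hpow 1
      rw [one_pow, ← Nat.sub_add_cancel (one_le_two.trans hn), pow_succ] at this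
      exact mul_right_cancel₀ hk0 (by rw [one_mul]; exact this.symm)
    have hmul (x : ℝ) : f 1 * f (x ^ 2) = f x ^ 2 := by
      rw [hsq, ← mul_assoc, ← pow_succ', show n - 2 + 1 = n - 1 by omega, hk, one_mul]
    have hk2 : f 1 = 1 ∨ f 1 = -1 := by
      rcases (pow_eq_one_iff_cases).mp hk with h0 | h1 | h1
      · omega
      · exact .inl h1
      · exact .inr h1.1
    have hkk : f 1 * f 1 = 1 := by rcases hk2 with h1 | h1 <;> norm_num [h1]
    let G : ℝ →+* ℝ := ((AddMonoidHom.mulLeft (f 1)).comp F).mkRingHomOfMulSelfOfTwoNeZero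
      (fun x => by
        change f 1 * f (x * x) = f 1 * f x * (f 1 * f x)
        rw [← sq, hmul]
        linear_combination (-f x ^ 2) * hkk)
      two_ne_zero hkk
    have hG (x : ℝ) : f 1 * f x = x :=
      DFunLike.congr_fun (Subsingleton.elim G (RingHom.id ℝ)) x
    rcases hk2 with h1 | h1
    · exact .inl fun x => by simpa [h1] using hG x
    · refine .inr ⟨?_, fun x => by have := hG x; rw [h1] at this; linarith⟩
      rw [h1, neg_one_pow_eq_one_iff_even (by norm_num)] at hk
      rw [← Nat.sub_add_cancel (one_le_two.trans hn)]
      exact hk.add_one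
  · rintro (h | ⟨hodd, h⟩) x y
    · simp only [h]
    · simp only [h, hodd.neg_pow]
      ring
end

section
/- Let f : ℝ → ℝ satisfy f(x) > 0 for all x > 0. Then f satisfies f(x + y + f(y)) = f(x) + 2y for all x > 0 and y > 0 if and only if f(x) = x for all x > 0. -/
theorem injOn_of_functional_eq {f : ℝ → ℝ} (hpos : ∀ x : ℝ, 0 < x → 0 < f x)
    (h : ∀ x : ℝ, 0 < x → ∀ y : ℝ, 0 < y → f (x + y + f y) = f x + 2 * y) :
    Set.InjOn f (Set.Ioi 0) := by
  intro a ha b hb hab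
  have hc := hpos a ha
  have hfc := hpos _ hc
  have h₁ := h _ hfc a ha
  have h₂ := h _ hfc b hb
  have h₃ := h a ha _ hc
  have h₄ := h b hb _ hc
  rw [show f (f a) + a + f a = a + f a + f (f a) by ring] at h₁
  rw [← hab, show f (f a) + b + f a = b + f a + f (f a) by ring] at h₂
  linarith

theorem map_add_of_functional_eq {f : ℝ → ℝ} (hpos : ∀ x : ℝ, 0 < x → 0 < f x)
    (h : ∀ x : ℝ, 0 < x → ∀ y : ℝ, 0 < y → f (x + y + f y) = f x + 2 * y)
    {y z : ℝ} (hy : 0 < y) (hz : 0 < z) : f (y + z) = f y + f z := by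
  have hfy := hpos y hy
  have hfz := hpos z hz
  have hyz := add_pos hy hz
  have hfyz := hpos _ hyz
  have h₁ := h 1 one_pos y hy
  have h₂ := h (1 + y + f y) (by positivity) z hz
  have h₃ := h 1 one_pos (y + z) hyz
  have heq : 1 + y + f y + z + f z = 1 + (y + z) + f (y + z) :=
    injOn_of_functional_eq hpos h (Set.mem_Ioi.2 (by positivity))
      (Set.mem_Ioi.2 (by positivity)) (by linarith)
  linarith

theorem problem_11 (f : ℝ → ℝ) (hpos : ∀ x : ℝ, 0 < x → 0 < f x) :
    (∀ x : ℝ, 0 < x → ∀ y : ℝ, 0 < y → f (x + y + f y) = f x + 2 * y) ↔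
    (∀ x : ℝ, 0 < x → f x = x) := by
  constructor
  · intro h
    have hadd {y z : ℝ} (hy : 0 < y) (hz : 0 < z) : f (y + z) = f y + f z :=
      map_add_of_functional_eq hpos h hy hz
    have hmono {y z : ℝ} (hy : 0 < y) (hyz : y < z) : f y < f z := by
      have hsum := hadd hy (sub_pos.2 hyz)
      rw [add_sub_cancel] at hsum
      linarith [hpos _ (sub_pos.2 hyz)]
    intro x hx
    have hfx := hpos x hx
    have hsum : f x + f (f x) = 2 * x := by
      have h₁ := h x hx x hx
      rw [hadd (add_pos hx hx) hfx, hadd hx hx] at h₁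
      linarith
    rcases lt_trichotomy (f x) x with hlt | heq | hgt
    · linarith [hmono hfx hlt]
    · exact heq
    · linarith [hmono hx hgt]
  · intro h x hx y hy
    rw [h y hy, h x hx, h _ (by positivity)]
    ring
end

section
/- Let f : ℝ → ℝ satisfy f(x) > 0 for all x > 0. Then f satisfies f(y)·f(x + f(y)) = f(x)·f(x·y) for all x > 0 and y > 0 if and only if there exists a constant c > 0 such that f(x) = c for all x > 0. -/
theorem problem_17 (f : ℝ → ℝ) (hpos : ∀ x : ℝ, 0 < x → 0 < f x) :
    (∀ x : ℝ, 0 < x → ∀ y : ℝ, 0 < y → f y * f (x + f y) = f x * f (x * y)) ↔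
    (∃ c : ℝ, 0 < c ∧ ∀ x : ℝ, 0 < x → f x = c) := by
  constructor
  · intro h
    obtain ⟨c, hc⟩ : ∃ c, f 1 = c := ⟨_, rfl⟩
    have hc0 : 0 < c := hc ▸ hpos 1 one_pos
    have shift : ∀ x, 0 < x → c * f (x + c) = f x * f x := by
      intro x hx
      simpa [hc] using h x hx 1 one_pos
    have f_one_add : f (1 + c) = c := by
      have := h 1 one_pos 1 one_pos
      rw [mul_one, hc] at this
      exact mul_left_cancel₀ hc0.ne' this
    have scale : ∀ x, 0 < x → f (x * (1 + c)) = f x := by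
      intro x hx
      have hxc := h x hx (1 + c) (by positivity)
      rw [f_one_add, shift x hx] at hxc
      exact (mul_left_cancel₀ (hpos x hx).ne' hxc).symm
    have periodic : ∀ v, c < v → f (v + c * c) = f v := by
      intro v hv
      obtain ⟨u, rfl⟩ : ∃ u, v = u * (1 + c) + c :=
        ⟨(v - c) / (1 + c), by field_simp; ring⟩
      have hu : 0 < u := by
        by_contra! hu
        nlinarith
      have h₁ := shift (u * (1 + c)) (by positivity)
      rw [scale u hu, ← shift u hu] at h₁
      rw [mul_left_cancel₀ hc0.ne' h₁, ← scale (u + c) (by positivity)]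
      congr 1
      ring
    have eq_of_one_lt : ∀ w, 1 < w → f w = c := by
      intro w hw
      have hw0 : 0 < w := one_pos.trans hw
      have hy : 0 < c⁻¹ := inv_pos.2 hc0
      have hfy := hpos _ hy
      have hx : c < w * c := by nlinarith
      have h₁ := h (w * c) (by positivity) c⁻¹ hy
      have h₂ := h (w * c + c * c) (by positivity) c⁻¹ hy
      rw [add_right_comm, periodic _ (by linarith), periodic _ hx, h₁] at h₂
      have h₃ := mul_left_cancel₀ (hpos (w * c) (by positivity)).ne' h₂
      rw [← add_mul, mul_inv_cancel_right₀ hc0.ne', mul_inv_cancel_right₀ hc0.ne'] at h₃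
      have h₄ := shift w hw0
      rw [← h₃] at h₄
      exact (mul_right_cancel₀ (hpos w hw0).ne' h₄).symm
    have scale_pow : ∀ (n : ℕ) x, 0 < x → f (x * (1 + c) ^ n) = f x := by
      intro n x hx
      induction n with
      | zero => simp
      | succ n ih => rw [pow_succ, ← mul_assoc, scale _ (by positivity), ih]
    refine ⟨c, hc0, fun x hx => ?_⟩
    obtain ⟨n, hn⟩ := pow_unbounded_of_one_lt x⁻¹ (lt_add_of_pos_right 1 hc0)
    rw [← scale_pow n x hx]
    exact eq_of_one_lt _ ((inv_lt_iff_one_lt_mul₀' hx).1 hn)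
  · rintro ⟨c, hc, hf⟩ x hx y hy
    rw [hf y hy, hf x hx, hf _ (add_pos hx hc), hf _ (mul_pos hx hy)]
end

section
/- For an integer n, there exists a function f : ℤ → ℤ satisfying f(x + y + f(y)) = f(x) + n·y for all integers x, y if and only if there exists an integer c such that n = c² + c. -/
/-- For `n ≠ 0`, a solution of the functional equation has no nonzero period. -/
theorem period_eq_zero {n : ℤ} (hn : n ≠ 0) {f : ℤ → ℤ}
    (hf : ∀ x y : ℤ, f (x + y + f y) = f x + n * y) {p : ℤ}
    (hp : ∀ x, f (x + p) = f x) : p = 0 := by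
  have h1 := hf 0 p
  have h2 := hf 0 0
  have h3 : f p = f 0 := by simpa using hp 0
  have h4 := hp (0 + 0 + f 0)
  rw [h3, show 0 + p + f 0 = 0 + 0 + f 0 + p by ring, h4, h2] at h1
  have h5 : n * p = 0 := by linarith
  exact (mul_eq_zero.mp h5).resolve_left hn

/-- For `n ≠ 0`, a solution of the functional equation is additive. -/
theorem map_add_of_functional_equation {n : ℤ} (hn : n ≠ 0) {f : ℤ → ℤ}
    (hf : ∀ x y : ℤ, f (x + y + f y) = f x + n * y) (y z : ℤ) :
    f (y + z) = f y + f z := by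
  have key : f y + f z - f (y + z) = 0 := by
    refine period_eq_zero hn hf fun x => ?_
    have h1 := hf (x - (y + z) - f (y + z)) (y + z)
    have h2 := hf (x - (y + z) - f (y + z)) y
    have h3 := hf (x - (y + z) - f (y + z) + y + f y) z
    rw [show x - (y + z) - f (y + z) + (y + z) + f (y + z) = x by ring] at h1
    rw [show x - (y + z) - f (y + z) + y + f y + z + f z
      = x + (f y + f z - f (y + z)) by ring] at h3
    rw [h3, h2, h1]
    ring
  linarith

theorem problem_18 (n : ℤ) :
    (∃ f : ℤ → ℤ, ∀ x y : ℤ, f (x + y + f y) = f x + n * y) ↔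
    (∃ c : ℤ, n = c ^ 2 + c) := by
  constructor
  · rintro ⟨f, hf⟩
    by_cases hn : n = 0
    · exact ⟨0, by simp [hn]⟩
    have hadd := map_add_of_functional_equation hn hf
    have hlin (m : ℤ) : f m = m * f 1 := by
      simpa using map_zsmul (AddMonoidHom.mk' f hadd) m 1
    refine ⟨f 1, ?_⟩
    have h := hf 0 1
    rw [hlin (0 + 1 + f 1), hlin 0] at h
    linarith
  · rintro ⟨c, rfl⟩
    exact ⟨fun x => c * x, fun x y => by ring⟩
end

section
/- A function f : ℤ → ℤ satisfies f(x − y + f(y)) = f(x) + f(y) for all integers x, y if and only if f(x) = 0 for all integers x, or f(x) = 2x for all integers x. -/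
theorem problem_20 (f : ℤ → ℤ) :
    (∀ x y : ℤ, f (x - y + f y) = f x + f y) ↔
    (∀ x : ℤ, f x = 0) ∨ (∀ x : ℤ, f x = 2 * x) := by
  constructor
  · intro h
    have zero : f 0 = 0 := by
      have shift : f 0 = f (-f 0) + f 0 := by simpa using h (-f 0) 0
      have vanish : f (-f 0) = 0 := by linarith
      have step : f (f 0) = f 0 := by simpa [vanish] using h 0 (-f 0)
      have double : f (f 0) = f 0 + f 0 := by simpa using h 0 0
      linarith
    -- `y ↦ f y - y` preserves `f` and is an involution, so `f` is additive.
    have invariant (y : ℤ) : f (f y - y) = f y := by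
      have h0 := h 0 y
      rwa [zero, zero_add, show 0 - y + f y = f y - y by ring] at h0
    have additive (x y : ℤ) : f (x + y) = f x + f y := by
      have hxy := h x (f y - y)
      rwa [invariant, show x - (f y - y) + f y = x + y by ring] at hxy
    have linear (x : ℤ) : f x = x * f 1 := by
      simpa using map_zsmul (AddMonoidHom.mk' f additive) x 1
    have double : f (f 1) = f 1 + f 1 := by simpa using h 1 1
    rw [linear (f 1)] at double
    have slope : f 1 * (f 1 - 2) = 0 := by linarith
    rcases mul_eq_zero.mp slope with h1 | h1
    · left
      intro x
      rw [linear, h1, mul_zero]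
    · right
      intro x
      rw [linear, sub_eq_zero.mp h1, mul_comm]
  · rintro (h | h) x y
    · simp [h]
    · simp only [h]
      ring
end

section
/- A function f : ℤ → ℤ satisfies f(x − f(y)) = f(f(x)) − f(y) − 1 for all integers x, y if and only if f(x) = −1 for all integers x, or f(x) = x + 1 for all integers x. -/
theorem eq_mul_add_of_sub_eq_const {f : ℤ → ℤ} {c : ℤ} (h : ∀ x, f (x + 1) - f x = c) (x : ℤ) :
    f x = c * x + f 0 := by
  induction x with
  | zero => ring
  | succ n ih => linear_combination ih + h n
  | pred n ih =>
    have h' := h (-n - 1)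
    rw [sub_add_cancel] at h'
    linear_combination ih - h'

theorem problem_21 (f : ℤ → ℤ) :
    (∀ x y : ℤ, f (x - f y) = f (f x) - f y - 1) ↔
    (∀ x : ℤ, f x = -1) ∨ (∀ x : ℤ, f x = x + 1) := by
  constructor
  · intro h
    obtain ⟨a, ha⟩ : ∃ a, f a = -1 := ⟨0 - f (f 0), by rw [h]; ring⟩
    have hff : ∀ x, f (x + 1) = f (f x) := fun x ↦ by simpa [ha] using h x a
    have hstep : ∀ x, f (x + 1) - f x = f (-1) + 1 := fun x ↦ by
      have hx := h (f x - 1) x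
      rw [← hff, sub_add_cancel, ← hff, sub_sub_cancel_left] at hx
      linear_combination -hx
    generalize f (-1) + 1 = c at hstep
    have hlin := eq_mul_add_of_sub_eq_const hstep
    have h0 := hff 0
    have h1 := hff 1
    rw [hlin, hlin (f 0)] at h0
    rw [hlin, hlin (f 1), hlin 1] at h1
    have hc : c * (c - 1) = 0 := by linear_combination h0 - h1
    rcases mul_eq_zero.mp hc with rfl | hc
    · refine .inl fun x ↦ ?_
      rw [← ha, hlin x, hlin a]
      ring
    · obtain rfl : c = 1 := sub_eq_zero.mp hc
      refine .inr fun x ↦ ?_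
      rw [hlin x]
      linear_combination -h0
  · rintro (h | h) x y
    · simp [h]
    · simp only [h]
      ring
end

section
/- Let f : ℤ → ℤ be monotone (either non-decreasing or non-increasing). Then f satisfies f(x²⁰¹⁵ + y²⁰¹⁵) = f(x)²⁰¹⁵ + f(y)²⁰¹⁵ for all integers x, y if and only if f(x) = x for all x, or f(x) = −x for all x, or f(x) = 0 for all x. -/
section PowerSums

variable {f : ℤ → ℤ} {n : ℕ}

lemma map_zero_of_map_pow_add_pow (hn : 2 ≤ n)
    (h : ∀ x y : ℤ, f (x ^ n + y ^ n) = f x ^ n + f y ^ n) : f 0 = 0 := by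
  have h0 := h 0 0
  rw [zero_pow (by omega), add_zero] at h0
  obtain ⟨m, rfl⟩ : ∃ m, n = m + 1 := ⟨n - 1, by omega⟩
  have h1 : f 0 * (1 - 2 * f 0 ^ m) = 0 := by rw [pow_succ] at h0; linarith
  rcases mul_eq_zero.mp h1 with h2 | h2
  · exact h2
  · omega

lemma map_pow_of_map_pow_add_pow (hn : 2 ≤ n)
    (h : ∀ x y : ℤ, f (x ^ n + y ^ n) = f x ^ n + f y ^ n) (x : ℤ) :
    f (x ^ n) = f x ^ n := by
  have h0 := h x 0
  rwa [map_zero_of_map_pow_add_pow hn h, zero_pow (by omega), add_zero, add_zero] at h0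

lemma map_pow_pow_of_map_pow_add_pow (hn : 2 ≤ n)
    (h : ∀ x y : ℤ, f (x ^ n + y ^ n) = f x ^ n + f y ^ n) (x : ℤ) (k : ℕ) :
    f (x ^ n ^ k) = f x ^ n ^ k := by
  induction k with
  | zero => simp
  | succ k ih =>
    rw [pow_succ n k, pow_mul, pow_mul, map_pow_of_map_pow_add_pow hn h, ih]

lemma map_neg_of_map_pow_add_pow (hn : 2 ≤ n) (hodd : Odd n)
    (h : ∀ x y : ℤ, f (x ^ n + y ^ n) = f x ^ n + f y ^ n) (x : ℤ) :
    f (-x) = -f x := by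
  have h0 := h (-x) x
  rw [hodd.neg_pow, neg_add_cancel, map_zero_of_map_pow_add_pow hn h] at h0
  apply hodd.strictMono_pow.injective
  change f (-x) ^ n = (-f x) ^ n
  rw [hodd.neg_pow]
  linarith

lemma lt_map_add_one_of_map_pow_add_pow (hn : 2 ≤ n) (hf : Monotone f)
    (h : ∀ x y : ℤ, f (x ^ n + y ^ n) = f x ^ n + f y ^ n) (h1 : 0 < f 1)
    {x : ℤ} (hx : 0 ≤ x) : f x < f (x + 1) := by
  rcases hx.eq_or_lt with rfl | hx
  · simpa [map_zero_of_map_pow_add_pow hn h] using h1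
  refine lt_of_le_of_ne (hf (by omega)) fun heq => ?_
  have hpos : 0 < f x := h1.trans_le (hf (by omega))
  obtain ⟨m, rfl⟩ := Int.eq_ofNat_of_zero_le hx.le
  set N := n ^ (m + 1) with hN
  have hmN : m ≤ N := (Nat.lt_pow_self (by omega : 1 < n)).le.trans
    (Nat.pow_le_pow_right (by omega) (Nat.le_succ m))
  have hN0 : N ≠ 0 := by positivity
  have hge : 2 * (m : ℤ) ^ N ≤ ((m : ℤ) + 1) ^ N := by
    have hb : (m : ℤ) ^ N + N * (m : ℤ) ^ (N - 1) ≤ ((m : ℤ) + 1) ^ N := by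
      simpa using pow_add_mul_le_add_pow (a := (m : ℤ)) (b := 1) (by omega) (by omega) N
    have hc : (m : ℤ) ^ N ≤ N * (m : ℤ) ^ (N - 1) := by
      rw [← mul_pow_sub_one hN0]
      gcongr
    linarith
  have e1 : f (2 * (m : ℤ) ^ N) = 2 * f m ^ N := by
    have := h ((m : ℤ) ^ n ^ m) ((m : ℤ) ^ n ^ m)
    rw [map_pow_pow_of_map_pow_add_pow hn h, ← pow_mul, ← pow_mul, ← pow_succ, ← hN] at this
    rw [two_mul, two_mul, this]
  have e2 := hf hge
  rw [e1, hN, map_pow_pow_of_map_pow_add_pow hn h, ← heq] at e2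
  have : 0 < f m ^ n ^ (m + 1) := by positivity
  omega

lemma eq_self_or_eq_zero_of_map_pow_add_pow (hn : 2 ≤ n) (hodd : Odd n) (hf : Monotone f)
    (h : ∀ x y : ℤ, f (x ^ n + y ^ n) = f x ^ n + f y ^ n) :
    (∀ x, f x = x) ∨ (∀ x, f x = 0) := by
  have hf0 := map_zero_of_map_pow_add_pow hn h
  have hneg := map_neg_of_map_pow_add_pow hn hodd h
  have h1n : f 1 = f 1 ^ n := by simpa using map_pow_of_map_pow_add_pow hn h 1
  have h2 : f 2 = 2 * f 1 := by
    have := h 1 1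
    rw [one_pow, ← h1n] at this
    rw [two_mul, ← this]; norm_num
  have hlt (m : ℕ) : (m : ℤ) ≤ 2 ^ n ^ m := by
    have : m < 2 ^ n ^ m := (Nat.lt_pow_self (by omega : 1 < n)).trans Nat.lt_two_pow_self
    exact_mod_cast this.le
  have hnonneg : 0 ≤ f 1 := by simpa [hf0] using hf (zero_le_one (α := ℤ))
  rcases hnonneg.eq_or_lt with h1 | h1
  · right
    have key (m : ℕ) : f m = 0 := by
      apply le_antisymm
      · have := hf (hlt m)
        rwa [map_pow_pow_of_map_pow_add_pow hn h, h2, ← h1, mul_zero,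
          zero_pow (by positivity)] at this
      · simpa [hf0] using hf (Int.natCast_nonneg m)
    intro x
    obtain ⟨m, rfl | rfl⟩ := x.eq_nat_or_neg
    · exact key m
    · rw [hneg, key, neg_zero]
  · left
    have h11 : f 1 = 1 := by
      by_contra hne
      have := pow_lt_pow_right₀ (by omega : 1 < f 1) (by omega : 1 < n)
      rw [pow_one] at this
      omega
    have hmono : Monotone fun m : ℕ => f m - m := by
      refine monotone_nat_of_le_succ fun m => ?_
      have := lt_map_add_one_of_map_pow_add_pow hn hf h h1 (Int.natCast_nonneg m)
      push_cast
      omega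
    have key (m : ℕ) : f m = m := by
      have hlow := hmono (Nat.zero_le m)
      have hhigh := hmono (show m ≤ 2 ^ n ^ m from by exact_mod_cast hlt m)
      simp only [Nat.cast_zero, hf0, Nat.cast_pow, Nat.cast_ofNat,
        map_pow_pow_of_map_pow_add_pow hn h, h2, h11, mul_one] at hlow hhigh
      omega
    intro x
    obtain ⟨m, rfl | rfl⟩ := x.eq_nat_or_neg
    · exact key m
    · rw [hneg, key]

end PowerSums

theorem problem_22 (f : ℤ → ℤ) (hmono : Monotone f ∨ Antitone f) :
    (∀ x y : ℤ, f (x ^ 2015 + y ^ 2015) = f x ^ 2015 + f y ^ 2015) ↔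
    (∀ x : ℤ, f x = x) ∨ (∀ x : ℤ, f x = -x) ∨ (∀ x : ℤ, f x = 0) := by
  have hodd : Odd 2015 := by decide
  have hn : 2 ≤ 2015 := by norm_num
  generalize 2015 = n at hodd hn ⊢
  constructor
  · intro h
    rcases hmono with hf | hf
    · rcases eq_self_or_eq_zero_of_map_pow_add_pow hn hodd hf h with h' | h'
      · exact Or.inl h'
      · exact Or.inr (Or.inr h')
    · have h' : ∀ x y : ℤ, (-f) (x ^ n + y ^ n) = (-f) x ^ n + (-f) y ^ n := fun x y => by
        simp only [Pi.neg_apply, hodd.neg_pow, h]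
        ring
      rcases eq_self_or_eq_zero_of_map_pow_add_pow hn hodd hf.neg h' with h' | h'
      · exact Or.inr (Or.inl fun x => neg_eq_iff_eq_neg.mp (h' x))
      · exact Or.inr (Or.inr fun x => neg_eq_zero.mp (h' x))
  · rintro (h | h | h) x y
    · simp only [h]
    · simp only [h, hodd.neg_pow]
      ring
    · simp only [h, zero_pow (by omega : n ≠ 0), add_zero]
end

section
/- Let f : ℝ → ℝ satisfy f(x) > 0 for all x > 0. Then f satisfies f(x + y + f(y)) = 4032·x − f(x) + f(2017·y) for all x > 0 and y > 0 if and only if f(x) = 2016·x for all x > 0. -/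
/-- A function on the positive reals that is periodic there and dominates a decreasing linear
function is bounded below. -/
lemma le_of_periodic_of_neg_mul_le {h : ℝ → ℝ} {a p : ℝ} (ha : 0 ≤ a) (hp : 0 < p)
    (hper : ∀ x, 0 < x → h (x + p) = h x) (hlow : ∀ x, 0 < x → -(a * x) ≤ h x)
    {x : ℝ} (hx : 0 < x) : -(a * p) ≤ h x := by
  have key : ∀ n : ℕ, ∀ x, 0 < x → x ≤ n * p → -(a * p) ≤ h x := by
    intro n
    induction n with
    | zero =>
      intro x hx hxn
      simp only [Nat.cast_zero, zero_mul] at hxn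
      linarith
    | succ n ih =>
      intro x hx hxn
      push_cast at hxn
      rcases le_or_gt x p with hxp | hxp
      · have := mul_le_mul_of_nonneg_left hxp ha
        linarith [hlow x hx]
      · have := ih (x - p) (by linarith) (by linarith)
        rwa [← hper (x - p) (by linarith), sub_add_cancel] at this
  obtain ⟨n, hn⟩ := exists_nat_ge (x / p)
  exact key n x hx ((div_le_iff₀ hp).mp hn)

/-- A bounded function on the positive reals that is multiplied by `a > 1` under a dilation
vanishes. -/
lemma eq_zero_of_dilation_of_bounded {k : ℝ → ℝ} {a b K : ℝ} (ha : 1 < a) (hb : 0 < b)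
    (hk : ∀ y, 0 < y → k (b * y) = a * k y) (hK : ∀ y, 0 < y → |k y| ≤ K)
    {y : ℝ} (hy : 0 < y) : k y = 0 := by
  have hpow : ∀ n : ℕ, k (b ^ n * y) = a ^ n * k y := by
    intro n
    induction n with
    | zero => simp
    | succ n ih => rw [pow_succ', mul_assoc, hk _ (by positivity), ih, pow_succ', mul_assoc]
  by_contra hne
  have hpos : 0 < |k y| := abs_pos.mpr hne
  obtain ⟨n, hn⟩ := pow_unbounded_of_one_lt (K / |k y|) ha
  have hbound := hK (b ^ n * y) (by positivity)
  rw [hpow, abs_mul, abs_of_pos (by positivity : 0 < a ^ n)] at hbound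
  rw [div_lt_iff₀ hpos] at hn
  linarith

theorem problem_23 (f : ℝ → ℝ) (hpos : ∀ x : ℝ, 0 < x → 0 < f x) :
    (∀ x : ℝ, 0 < x → ∀ y : ℝ, 0 < y →
      f (x + y + f y) = 4032 * x - f x + f (2017 * y)) ↔
    (∀ x : ℝ, 0 < x → f x = 2016 * x) := by
  constructor
  · intro hf
    set h : ℝ → ℝ := fun x => f x - 2016 * x with hh
    set s : ℝ → ℝ := fun y => y + f y with hs
    set c : ℝ → ℝ := fun y => h (2017 * y) - 2016 * h y with hc
    have s_pos : ∀ y, 0 < y → 0 < s y := fun y hy => add_pos hy (hpos y hy)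
    have h_shift : ∀ x, 0 < x → ∀ y, 0 < y → h (x + s y) = c y - h x := by
      intro x hx y hy
      have := hf x hx y hy
      simp only [hc, hh, hs, ← add_assoc]
      linarith
    have c_const : ∀ y, 0 < y → c y = c 1 := by
      intro y hy
      have h₁ := h_shift (1 + s y) (add_pos one_pos (s_pos y hy)) 1 one_pos
      have h₂ := h_shift (1 + s 1) (add_pos one_pos (s_pos 1 one_pos)) y hy
      rw [h_shift 1 one_pos y hy] at h₁
      rw [h_shift 1 one_pos 1 one_pos, add_right_comm] at h₂
      linarith
    have h_lower : ∀ x, 0 < x → -(2016 * (s 1 + s 1)) ≤ h x := by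
      intro x hx
      have s1 := s_pos 1 one_pos
      refine le_of_periodic_of_neg_mul_le (by norm_num) (add_pos s1 s1) ?_ ?_ hx
      · intro x hx
        rw [← add_assoc, h_shift _ (add_pos hx s1) 1 one_pos, h_shift x hx 1 one_pos]
        ring
      · intro x hx
        have := hpos x hx
        simp only [hh]
        linarith
    have h_upper : ∀ x, 0 < x → h x ≤ c 1 + 2016 * (s 1 + s 1) := by
      intro x hx
      have h₁ := h_shift x hx 1 one_pos
      have h₂ := h_lower (x + s 1) (add_pos hx (s_pos 1 one_pos))
      linarith
    have h_const : ∀ y, 0 < y → h y + c 1 / 2015 = 0 := by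
      intro y hy
      refine eq_zero_of_dilation_of_bounded (k := fun y => h y + c 1 / 2015) (a := 2016)
        (b := 2017) (K := |c 1| + 2016 * (s 1 + s 1) + |c 1 / 2015|)
        (by norm_num) (by norm_num) ?_ ?_ hy
      · intro y hy
        have : h (2017 * y) - 2016 * h y = c 1 := c_const y hy
        linarith
      · intro y hy
        refine (abs_add_le _ _).trans (add_le_add_left (abs_le.mpr ⟨?_, ?_⟩) _)
        · linarith [h_lower y hy, abs_nonneg (c 1)]
        · linarith [h_upper y hy, le_abs_self (c 1)]
    intro x hx
    have h₁ := h_shift 1 one_pos 1 one_pos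
    have h₂ := h_const 1 one_pos
    have h₃ := h_const (1 + s 1) (add_pos one_pos (s_pos 1 one_pos))
    have h₄ : f x - 2016 * x + c 1 / 2015 = 0 := h_const x hx
    linarith
  · intro hf x hx y hy
    have := hpos y hy
    rw [hf (x + y + f y) (by positivity), hf x hx, hf y hy, hf (2017 * y) (by positivity)]
    ring
end

section
/- Let Q be a real polynomial of degree at least 2. A function f : ℝ → ℝ satisfies f(x + Q(y) + f(y)) = f(x) for all real x, y if and only if f(y) = −Q(y) for all real y, or f is constant. -/
/-- A real polynomial whose increment by a nonzero step is constant has degree at most one. -/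
theorem natDegree_le_one_of_eval_add_sub_eq (Q : Polynomial ℝ) {T c : ℝ} (hT : T ≠ 0)
    (h : ∀ y, Q.eval (y + T) - Q.eval y = c) : Q.natDegree ≤ 1 := by
  have hval (n : ℕ) : Q.eval (n * T) = Q.eval 0 + n * c := by
    induction n with
    | zero => simp
    | succ n ih =>
      have := h (n * T)
      push_cast
      rw [add_one_mul]
      linarith
  have hQ : Q = Polynomial.C (c / T) * Polynomial.X + Polynomial.C (Q.eval 0) := by
    refine Polynomial.eq_of_infinite_eval_eq _ _ (Set.Infinite.mono ?_
      (Set.infinite_range_of_injective (f := fun n : ℕ => (n : ℝ) * T) fun m n hmn => ?_))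
    · rintro _ ⟨n, rfl⟩
      simp only [Set.mem_ofPred_eq, hval, Polynomial.eval_add, Polynomial.eval_mul,
        Polynomial.eval_C, Polynomial.eval_X]
      field_simp
      ring
    · exact_mod_cast mul_right_cancel₀ hT hmn
  rw [hQ]
  exact Polynomial.natDegree_linear_le

/-- A function having every value of a nonconstant real polynomial as a period has every real
number as a period. -/
theorem periodic_of_forall_periodic_eval {f : ℝ → ℝ} {D : Polynomial ℝ} (hD : 0 < D.degree)
    (h : ∀ y, Function.Periodic f (D.eval y)) (t : ℝ) : Function.Periodic f t := by
  have hlarge (s : ℝ) (hs : |D.eval 0| ≤ s) : Function.Periodic f s := by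
    have htop := D.abs_tendsto_atTop hD
    obtain ⟨b, hb⟩ := (htop.eventually_ge_atTop s).exists
    obtain ⟨y, rfl⟩ := mem_range_of_exists_le_of_exists_ge D.continuous.abs ⟨0, hs⟩ ⟨b, hb⟩
    rcases abs_choice (D.eval y) with h' | h' <;> simp only [h']
    · exact h y
    · exact (h y).neg
  have := (hlarge (|D.eval 0| + |t| + t) (by linarith [neg_abs_le t])).sub_period
    (hlarge (|D.eval 0| + |t|) (by linarith [abs_nonneg t]))
  simpa using this

theorem problem_24 (Q : Polynomial ℝ) (hQ : 2 ≤ Q.natDegree) (f : ℝ → ℝ) :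
    (∀ x y : ℝ, f (x + Q.eval y + f y) = f x) ↔
    (∀ y : ℝ, f y = -Q.eval y) ∨ (∃ c : ℝ, ∀ x : ℝ, f x = c) := by
  constructor
  · intro h
    have hper (y : ℝ) : Function.Periodic f (Q.eval y + f y) := fun x => by
      rw [← add_assoc, h]
    by_cases hf : ∀ y, f y = -Q.eval y
    · exact Or.inl hf
    push Not at hf
    obtain ⟨a, ha⟩ := hf
    set T := Q.eval a + f a
    have hT : T ≠ 0 := fun h0 => ha (by linarith)
    have hD : 0 < (Polynomial.taylor T Q - Q).degree := by
      by_contra! hle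
      have hconst := Polynomial.eq_C_of_degree_le_zero hle
      have := natDegree_le_one_of_eval_add_sub_eq Q hT
        (c := (Polynomial.taylor T Q - Q).coeff 0) fun y => by
          simpa [Polynomial.taylor_eval] using congrArg (Polynomial.eval y) hconst
      omega
    have hDper (y : ℝ) : Function.Periodic f ((Polynomial.taylor T Q - Q).eval y) := by
      have := (hper (y + T)).sub_period (hper y)
      rw [hper a y] at this
      simpa [Polynomial.taylor_eval] using this
    refine Or.inr ⟨f 0, fun x => ?_⟩
    simpa using periodic_of_forall_periodic_eval hD hDper x 0
  · rintro (h | ⟨c, h⟩) x y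
    · rw [h y, add_neg_cancel_right]
    · rw [h, h]
end

section
/- Let P be a real polynomial of degree at least 2 with P(x) > 0 for all x > 0, and let f : ℝ → ℝ satisfy f(x) > 0 for all x > 0. Then f satisfies f(f(x) + P(x) + 2y) = f(x) + P(x) + 2·f(y) for all x > 0 and y > 0 if and only if f(x) = x for all x > 0. -/
open Filter

/-- `f` eventually commutes with the translation by `c`. -/
def EventuallyTranslates (f : ℝ → ℝ) (c : ℝ) : Prop :=
  ∀ᶠ t in atTop, f (t + c) = f t + c

lemma EventuallyTranslates.sub {f : ℝ → ℝ} {c d : ℝ} (hc : EventuallyTranslates f c)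
    (hd : EventuallyTranslates f d) : EventuallyTranslates f (c - d) := by
  have hc' := (tendsto_atTop_add_const_right atTop (-d) tendsto_id).eventually hc
  have hd' := (tendsto_atTop_add_const_right atTop (-d) tendsto_id).eventually hd
  filter_upwards [hc', hd'] with t h₁ h₂
  simp only [id, neg_add_cancel_right] at h₁ h₂
  rw [show t + (c - d) = t + -d + c by ring]
  linarith

lemma Polynomial.tendsto_eval_atTop_of_pos {P : Polynomial ℝ} (hdeg : 0 < P.degree)
    (hP : ∀ x : ℝ, 0 < x → 0 < P.eval x) :
    0 < P.leadingCoeff ∧ Tendsto (fun x => P.eval x) atTop atTop := by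
  have hlead : 0 ≤ P.leadingCoeff := by
    by_contra! h
    obtain ⟨x, hx, hx'⟩ := ((P.tendsto_atBot_of_leadingCoeff_nonpos hdeg h.le).eventually
      (eventually_lt_atBot 0) |>.and (eventually_gt_atTop 0)).exists
    exact (hP x hx').not_gt hx
  refine ⟨hlead.lt_of_ne' fun h => ?_, P.tendsto_atTop_of_leadingCoeff_nonneg hdeg hlead⟩
  simp [Polynomial.leadingCoeff_eq_zero.mp h] at hdeg

lemma Polynomial.tendsto_eval_add_sub_eval_atTop {P : Polynomial ℝ} (hdeg : 2 ≤ P.natDegree)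
    (hlead : 0 < P.leadingCoeff) {d : ℝ} (hd : 0 < d) :
    Tendsto (fun x => P.eval (x + d) - P.eval x) atTop atTop := by
  have hdeg' : P.derivative.natDegree = P.natDegree - 1 := P.natDegree_derivative
  have hlead' : 0 ≤ P.derivative.leadingCoeff := by
    rw [Polynomial.leadingCoeff, hdeg', Polynomial.coeff_derivative,
      Nat.sub_add_cancel (by omega)]
    exact mul_nonneg hlead.le (by positivity)
  have ht := P.derivative.tendsto_atTop_of_leadingCoeff_nonneg
    (Polynomial.natDegree_pos_iff_degree_pos.mp (by omega)) hlead'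
  refine tendsto_atTop.mpr fun M => ?_
  obtain ⟨X, hX⟩ := eventually_atTop.mp (tendsto_atTop.mp ht (M / d))
  filter_upwards [eventually_ge_atTop X] with x hx
  obtain ⟨ξ, hξ, hslope⟩ := exists_hasDerivAt_eq_slope (fun x => P.eval x)
    (fun x => P.derivative.eval x) (lt_add_of_pos_right x hd) P.continuous.continuousOn
    fun y _ => P.hasDerivAt y
  have := hX ξ (hx.trans hξ.1.le)
  rw [hslope, add_sub_cancel_left, div_le_div_iff_of_pos_right hd] at this
  exact this

lemma eventuallyTranslates_of_functional_eq {P : Polynomial ℝ} (hdeg : 2 ≤ P.natDegree)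
    (hP : ∀ x : ℝ, 0 < x → 0 < P.eval x) {f : ℝ → ℝ} (hpos : ∀ x : ℝ, 0 < x → 0 < f x)
    (hf : ∀ x : ℝ, 0 < x → ∀ y : ℝ, 0 < y →
      f (f x + P.eval x + 2 * y) = f x + P.eval x + 2 * f y) (c : ℝ) :
    EventuallyTranslates f c := by
  obtain ⟨hlead, hlim⟩ := Polynomial.tendsto_eval_atTop_of_pos
    (Polynomial.natDegree_pos_iff_degree_pos.mp (by omega)) hP
  have hdiff : ∀ x z : ℝ, 0 < x → 0 < z →
      EventuallyTranslates f (f x + P.eval x - (f z + P.eval z)) := by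
    intro x z hx hz
    filter_upwards [eventually_gt_atTop (f z + P.eval z)] with t ht
    have hy : 0 < (t - (f z + P.eval z)) / 2 := by linarith
    have h₁ := hf x hx _ hy
    have h₂ := hf z hz _ hy
    rw [mul_div_cancel₀ _ two_ne_zero] at h₁ h₂
    rw [add_sub_cancel] at h₂
    rw [show t + (f x + P.eval x - (f z + P.eval z))
      = f x + P.eval x + (t - (f z + P.eval z)) by ring]
    linarith
  obtain ⟨d, hd, hdt⟩ : ∃ d, 0 < d ∧ EventuallyTranslates f d := by
    obtain ⟨x, hx, hx'⟩ := ((hlim.eventually (eventually_gt_atTop (f 1 + P.eval 1))).and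
      (eventually_gt_atTop 0)).exists
    exact ⟨_, by linarith [hpos x hx'], hdiff x 1 hx' one_pos⟩
  have hstep : ∀ᶠ x in atTop, EventuallyTranslates f (P.eval (x + d) - P.eval x) := by
    filter_upwards [hdt, eventually_gt_atTop 0] with x hx hx'
    have := (hdiff (x + d) x (by linarith) hx').sub hdt
    rw [hx] at this
    convert this using 1
    ring
  have hlarge : ∃ M, ∀ m ≥ M, EventuallyTranslates f m := by
    obtain ⟨X, hX⟩ := eventually_atTop.mp hstep
    refine ⟨P.eval (X + d) - P.eval X, fun m hm => ?_⟩
    have hQ := Polynomial.tendsto_eval_add_sub_eval_atTop hdeg hlead hd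
    obtain ⟨Y, hY, hXY⟩ := ((hQ.eventually (eventually_ge_atTop m)).and
      (eventually_ge_atTop X)).exists
    obtain ⟨x, hx, rfl⟩ := intermediate_value_Icc (f := fun x => P.eval (x + d) - P.eval x) hXY
      (by fun_prop) ⟨hm, hY⟩
    exact hX x hx.1
  obtain ⟨M, hM⟩ := hlarge
  have := (hM (M + |c| + c) (by linarith [neg_abs_le c])).sub
    (hM (M + |c|) (by linarith [abs_nonneg c]))
  rwa [add_sub_cancel_left] at this

theorem problem_25 (P : Polynomial ℝ) (hdeg : 2 ≤ P.natDegree)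
    (hP : ∀ x : ℝ, 0 < x → 0 < P.eval x)
    (f : ℝ → ℝ) (hpos : ∀ x : ℝ, 0 < x → 0 < f x) :
    (∀ x : ℝ, 0 < x → ∀ y : ℝ, 0 < y →
      f (f x + P.eval x + 2 * y) = f x + P.eval x + 2 * f y) ↔
    (∀ x : ℝ, 0 < x → f x = x) := by
  refine ⟨fun hf => ?_, fun h x hx y hy => ?_⟩
  · have hlim := (Polynomial.tendsto_eval_atTop_of_pos
      (Polynomial.natDegree_pos_iff_degree_pos.mp (by omega)) hP).2
    have htrans : ∀ y c : ℝ, 0 < y → 0 < c → f (y + c) = f y + c := by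
      intro y c hy hc
      obtain ⟨T, hT⟩ := eventually_atTop.mp
        (eventuallyTranslates_of_functional_eq hdeg hP hpos hf (2 * c))
      obtain ⟨x, hx, hx'⟩ := ((hlim.eventually (eventually_ge_atTop T)).and
        (eventually_gt_atTop 0)).exists
      have h₁ := hf x hx' y hy
      have h₂ := hf x hx' (y + c) (by linarith)
      have h₃ := hT (f x + P.eval x + 2 * y) (by linarith [hpos x hx'])
      rw [mul_add, ← add_assoc] at h₂
      linarith
    intro x hx
    have h₁ := hf x hx x hx
    have hg : 0 < f x + P.eval x := add_pos (hpos x hx) (hP x hx)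
    have h₂ := htrans x (f x + P.eval x + x) hx (by linarith)
    rw [show x + (f x + P.eval x + x) = f x + P.eval x + 2 * x by ring] at h₂
    linarith
  · have := hP x hx
    rw [h x hx, h y hy, h _ (by linarith)]
end

section
/- Let f : ℝ → ℝ satisfy f(x) > 0 for all x > 0. Then f satisfies f(1 + x·f(y)) = y·f(x + y) for all x > 0 and y > 0 if and only if f(x) = 1/x for all x > 0. -/
section

variable {f : ℝ → ℝ}

lemma le_one_of_one_lt
    (h : ∀ x : ℝ, 0 < x → ∀ y : ℝ, 0 < y → f (1 + x * f y) = y * f (x + y))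
    (hpos : ∀ x : ℝ, 0 < x → 0 < f x) {y : ℝ} (hy : 1 < y) : f y ≤ 1 := by
  by_contra! hf
  have hd : 0 < f y - 1 := by linarith
  have hx : 0 < (y - 1) / (f y - 1) := div_pos (by linarith) hd
  have key := h _ hx y (by linarith)
  have heq : 1 + (y - 1) / (f y - 1) * f y = (y - 1) / (f y - 1) + y := by
    field_simp
    ring
  rw [heq] at key
  have := hpos ((y - 1) / (f y - 1) + y) (by linarith)
  nlinarith

lemma mul_apply_le_one
    (h : ∀ x : ℝ, 0 < x → ∀ y : ℝ, 0 < y → f (1 + x * f y) = y * f (x + y))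
    (hpos : ∀ x : ℝ, 0 < x → 0 < f x) {z : ℝ} (hz : 0 < z) : z * f z ≤ 1 := by
  have hfz := hpos z hz
  by_contra! hlt
  have hinv : 1 / f z < z := by rwa [div_lt_iff₀ hfz]
  have hinv_pos : 0 < 1 / f z := by positivity
  set y := (z + 1 / f z) / 2 with hy
  have hy0 : 0 < y := by positivity
  have hyz : 0 < z - y := by linarith
  have key := h (z - y) hyz y hy0
  have hle := le_one_of_one_lt h hpos
    (lt_add_of_pos_right 1 (mul_pos hyz (hpos y hy0)))
  rw [key, sub_add_cancel] at hle
  have : y * f z = (z * f z + 1) / 2 := by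
    rw [hy]
    field_simp
  linarith

lemma two_mul_apply_add
    (h : ∀ x : ℝ, 0 < x → ∀ y : ℝ, 0 < y → f (1 + x * f y) = y * f (x + y))
    (hpos : ∀ x : ℝ, 0 < x → 0 < f x) {w t : ℝ} (hw : 0 < w) (ht : 0 < t) :
    2 * f (2 * w + t) = (1 + w * f w) * f (2 * w + t / (w * f w)) := by
  have hfw := hpos w hw
  have hx : 0 < t / w := div_pos ht hw
  have h₁ := h (t / w) hx (1 + w * f w) (by positivity)
  have h₂ := h t ht (w + w) (by positivity)
  have h₃ := h (t / w / f w + w) (by positivity) w hw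
  rw [h w hw w hw, ← mul_assoc, div_mul_cancel₀ t hw.ne', h₂] at h₁
  have e : 1 + (t / w / f w + w) * f w = t / w + (1 + w * f w) := by
    field_simp
    ring
  rw [e] at h₃
  rw [h₃] at h₁
  have e₁ : t + (w + w) = 2 * w + t := by ring
  have e₂ : t / w / f w + w + w = 2 * w + t / (w * f w) := by
    rw [div_div]
    ring
  rw [e₁, e₂] at h₁
  apply mul_left_cancel₀ hw.ne'
  linarith

lemma one_le_mul_apply
    (h : ∀ x : ℝ, 0 < x → ∀ y : ℝ, 0 < y → f (1 + x * f y) = y * f (x + y))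
    (hpos : ∀ x : ℝ, 0 < x → 0 < f x) {w : ℝ} (hw : 0 < w) : 1 ≤ w * f w := by
  by_contra! hg
  have hg0 : 0 < w * f w := mul_pos hw (hpos w hw)
  have hρ : 1 < 2 / (1 + w * f w) := by
    rw [lt_div_iff₀ (by positivity)]
    linarith
  have hiter : ∀ n : ℕ,
      f (2 * w + 1 / (w * f w) ^ n) = (2 / (1 + w * f w)) ^ n * f (2 * w + 1) := by
    intro n
    induction n with
    | zero => simp
    | succ n ih =>
      have key := two_mul_apply_add h hpos hw (t := 1 / (w * f w) ^ n) (by positivity)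
      rw [ih, div_div, ← pow_succ] at key
      rw [pow_succ (2 / (1 + w * f w))]
      field_simp at key ⊢
      linarith
  have hc : 0 < f (2 * w + 1) := hpos _ (by positivity)
  obtain ⟨n, hn⟩ := pow_unbounded_of_one_lt (1 / (2 * w) / f (2 * w + 1)) hρ
  rw [div_lt_iff₀ hc, ← hiter, div_lt_iff₀ (by positivity)] at hn
  have hp : 0 < 1 / (w * f w) ^ n := by positivity
  have hle := mul_apply_le_one h hpos (z := 2 * w + 1 / (w * f w) ^ n) (by positivity)
  have := mul_pos hp (hpos (2 * w + 1 / (w * f w) ^ n) (by positivity))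
  linarith

end

theorem problem_28 (f : ℝ → ℝ) (hpos : ∀ x : ℝ, 0 < x → 0 < f x) :
    (∀ x : ℝ, 0 < x → ∀ y : ℝ, 0 < y → f (1 + x * f y) = y * f (x + y)) ↔
    (∀ x : ℝ, 0 < x → f x = 1 / x) := by
  constructor
  · intro h x hx
    rw [eq_div_iff hx.ne', mul_comm]
    exact le_antisymm (mul_apply_le_one h hpos hx) (one_le_mul_apply h hpos hx)
  · intro h x hx y hy
    have := hpos y hy
    rw [h (1 + x * f y) (by positivity), h (x + y) (by positivity), h y hy]
    field_simp
    ring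
end
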